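/- Let k be a differential field of characteristic zero with derivation d whose field of constants C is algebraically closed, let A be an n×n matrix over k, and let R be a Picard–Vessiot ring for d(Y) = A·Y over k. Then R is an integral domain and the field of constants of its fraction field Frac(R), equipped with the unique extension of the derivation, is equal to C. -/

import Mathlib

/-- `R` (with derivation `dR`) is a Picard–Vessiot ring for the equation `d(Y) = A·Y`
over the differential field `(k, dk)`. -/
def IsPicardVessiotRing {k : Type*} [Field k] {n : Type*} [Fintype n] [DecidableEq n]
    (dk : k → k) (A : Matrix n n k)
    (R : Type*) [CommRing R] [Algebra k R] (dR : R → R) : Prop :=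
  (∀ a b : R, dR (a + b) = dR a + dR b) ∧
  (∀ a b : R, dR (a * b) = a * dR b + dR a * b) ∧
  (∀ a : k, dR (algebraMap k R a) = algebraMap k R (dk a)) ∧
  ((⊥ : Ideal R) ≠ ⊤) ∧
  (∀ I : Ideal R, (∀ a ∈ I, dR a ∈ I) → I = ⊥ ∨ I = ⊤) ∧
  (∃ (Z : Matrix n n R) (w : R),
    Z.det * w = 1 ∧
    Z.map dR = A.map (algebraMap k R) * Z ∧
    Algebra.adjoin k ((Set.range fun p : n × n => Z p.1 p.2) ∪ {w}) = ⊤)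

open Polynomial in
/-- Transcendental elements of a finitely generated domain over a field have only finitely many
translates by scalars that are units. -/
theorem Transcendental.exists_not_isUnit_sub {k R : Type*} [Field k] [CommRing R] [IsDomain R]
    [Algebra k R] [Algebra.FiniteType k R] {c : R} (hc : Transcendental k c)
    {S : Set k} (hS : S.Infinite) : ∃ l ∈ S, ¬ IsUnit (c - algebraMap k R l) := by
  classical
  let : Algebra k[X] R := (Polynomial.aeval c).toRingHom.toAlgebra
  have hmap (p : k[X]) : algebraMap k[X] R p = Polynomial.aeval c p := rfl
  have : IsScalarTower k k[X] R :=
    IsScalarTower.of_algebraMap_eq fun a ↦ by simp [hmap]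
  have hinj : Function.Injective (algebraMap k[X] R) := transcendental_iff_injective.1 hc
  have : FaithfulSMul k[X] R := (faithfulSMul_iff_algebraMap_injective _ _).2 hinj
  have : Algebra.FiniteType k[X] R := Algebra.FiniteType.of_restrictScalars_finiteType k k[X] R
  have : Algebra.FinitePresentation k[X] R :=
    Algebra.FinitePresentation.of_finiteType.1 inferInstance
  have hopen := (PrimeSpectrum.isOpenMap_comap_of_hasGoingDown_of_finitePresentation
    (R := k[X]) (S := R)).isOpen_range
  obtain ⟨_, ⟨f, rfl⟩, hxf, hfU⟩ :=
    PrimeSpectrum.isTopologicalBasis_basic_opens.exists_subset_of_mem_open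
      (Set.mem_range_self (f := PrimeSpectrum.comap (algebraMap k[X] R)) ⊥) hopen
  have hf : f ≠ 0 := by
    rintro rfl
    simp at hxf
  obtain ⟨l, hlS, hl⟩ := hS.exists_notMem_finset f.roots.toFinset
  refine ⟨l, hlS, fun hu ↦ ?_⟩
  have hprime : (Ideal.span {X - C l}).IsPrime :=
    (Ideal.span_singleton_prime (X_sub_C_ne_zero l)).2 (prime_X_sub_C l)
  have hmem : (⟨_, hprime⟩ : PrimeSpectrum k[X]) ∈ (PrimeSpectrum.basicOpen f : Set _) := by
    change f ∉ Ideal.span {X - C l}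
    rw [Ideal.mem_span_singleton, dvd_iff_isRoot]
    simpa [hf] using hl
  obtain ⟨q, hq⟩ := hfU hmem
  have hXq : X - C l ∈ (PrimeSpectrum.comap (algebraMap k[X] R) q).asIdeal := by
    rw [hq]
    exact Ideal.mem_span_singleton_self _
  refine q.2.ne_top (Ideal.eq_top_of_isUnit_mem _ ?_ hu)
  simpa [hmap] using hXq

/-- The general Leibniz rule for iterates of a derivation. -/
theorem Derivation.iterate_mul {A R : Type*} [CommSemiring A] [CommRing R] [Algebra A R]
    (D : Derivation A R R) (n : ℕ) (a b : R) :
    D^[n] (a * b) =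
      ∑ ij ∈ Finset.HasAntidiagonal.antidiagonal n,
        n.choose ij.1 • (D^[ij.1] a * D^[ij.2] b) := by
  induction n with
  | zero => simp
  | succ n ih =>
    rw [Finset.sum_antidiagonal_choose_succ_nsmul (fun i j ↦ D^[i] a * D^[j] b) n]
    simp only [Function.iterate_succ_apply', ih, map_sum, map_nsmul, Derivation.leibniz,
      smul_eq_mul, smul_add, Finset.sum_add_distrib, add_right_inj]
    refine Finset.sum_congr rfl fun ⟨i, j⟩ hij ↦ ?_
    rw [n.choose_symm_of_eq_add (Finset.HasAntidiagonal.mem_antidiagonal.1 hij).symm, mul_comm]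

/-- The largest differential ideal contained in a given ideal. -/
def Derivation.idealCore {A R : Type*} [CommSemiring A] [CommRing R] [Algebra A R]
    (D : Derivation A R R) (P : Ideal R) : Ideal R where
  carrier := {a | ∀ n, D^[n] a ∈ P}
  zero_mem' n := by simp [iterate_map_zero]
  add_mem' ha hb n := by
    rw [iterate_map_add]
    exact P.add_mem (ha n) (hb n)
  smul_mem' c a ha n := by
    rw [smul_eq_mul, D.iterate_mul]
    exact P.sum_mem fun ij _ ↦ P.nsmul_mem (P.mul_mem_left _ (ha _)) _

/-- In a `ℚ`-algebra, the largest differential ideal contained in a prime ideal is prime. -/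
theorem Derivation.isPrime_idealCore {A R : Type*} [CommSemiring A] [CommRing R] [Algebra A R]
    [Algebra ℚ R] (D : Derivation A R R) (P : Ideal R) [P.IsPrime] : (D.idealCore P).IsPrime := by
  classical
  refine ⟨fun h ↦ Ideal.IsPrime.ne_top ‹_› <| (Ideal.eq_top_iff_one P).2 <|
    (Ideal.eq_top_iff_one _).1 h 0, fun {a b} hab ↦ ?_⟩
  by_contra! h
  have ha : ∃ n, D^[n] a ∉ P := not_forall.1 h.1
  have hb : ∃ n, D^[n] b ∉ P := not_forall.1 h.2
  set m := Nat.find ha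
  set n := Nat.find hb
  have hsum := hab (m + n)
  rw [D.iterate_mul, ← Finset.add_sum_erase _ _
    (Finset.HasAntidiagonal.mem_antidiagonal.2 rfl :
      (m, n) ∈ Finset.HasAntidiagonal.antidiagonal (m + n))] at hsum
  have hrest : ∑ ij ∈ (Finset.HasAntidiagonal.antidiagonal (m + n)).erase (m, n),
      (m + n).choose ij.1 • (D^[ij.1] a * D^[ij.2] b) ∈ P := by
    refine P.sum_mem fun ij hij ↦ P.nsmul_mem ?_ _
    obtain ⟨hne, hij⟩ := Finset.mem_erase.1 hij
    rw [Finset.HasAntidiagonal.mem_antidiagonal] at hij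
    rcases lt_or_ge ij.1 m with hlt | hge
    · exact P.mul_mem_right _ (not_not.1 (Nat.find_min ha hlt))
    · have hlt : ij.2 < n := by
        by_contra! hle
        exact hne (Prod.ext (by lia) (by lia))
      exact P.mul_mem_left _ (not_not.1 (Nat.find_min hb hlt))
  have hmain := (P.add_mem_iff_left hrest).1 hsum
  have hunit : IsUnit (((m + n).choose m : ℕ) : R) := by
    have h0 : (((m + n).choose m : ℕ) : ℚ) ≠ 0 :=
      Nat.cast_ne_zero.2 (Nat.choose_pos (Nat.le_add_right m n)).ne'
    simpa using h0.isUnit.map (algebraMap ℚ R)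
  rw [nsmul_eq_mul, Ideal.unit_mul_mem_iff_mem P hunit] at hmain
  exact (Ideal.IsPrime.mem_or_mem ‹_› hmain).elim (Nat.find_spec ha) (Nat.find_spec hb)

namespace Differential

open Polynomial
open scoped Differential

/-- A differential ring is simple if it is nontrivial and has no differential ideals besides
the trivial ones. -/
structure IsSimple (R : Type*) [CommRing R] [Differential R] : Prop where
  nontrivial : Nontrivial R
  eq_bot_or_eq_top (I : Ideal R) (hI : ∀ a ∈ I, a′ ∈ I) : I = ⊥ ∨ I = ⊤

variable {k R : Type*} [Field k] [Differential k] [CommRing R] [Differential R]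

/-- A simple differential ring containing the rationals is a domain. -/
theorem IsSimple.isDomain [Algebra ℚ R] (hR : IsSimple R) : IsDomain R := by
  have := hR.nontrivial
  obtain ⟨P, hP⟩ := Ideal.exists_maximal R
  have := hP.isPrime
  have hprime := (Differential.deriv (R := R)).isPrime_idealCore P
  have h := (hR.eq_bot_or_eq_top (Differential.deriv.idealCore P) fun a ha n ↦ by
    simpa only [Function.iterate_succ_apply] using ha (n + 1)).resolve_right hprime.ne_top
  rw [h] at hprime
  exact IsDomain.of_bot_isPrime R

/-- Nonzero constants of a simple differential ring are units. -/
theorem IsSimple.isUnit_of_deriv_eq_zero (hR : IsSimple R) {c : R} (hc : c′ = 0) (h0 : c ≠ 0) :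
    IsUnit c := by
  rw [← Ideal.span_singleton_eq_top]
  refine (hR.eq_bot_or_eq_top _ fun a ha ↦ ?_).resolve_left (by simpa using h0)
  obtain ⟨r, rfl⟩ := Ideal.mem_span_singleton'.1 ha
  simpa [hc] using Ideal.mul_mem_right _ _ (Ideal.mem_span_singleton_self c)

/-- Algebraic constants over a field with algebraically closed constants lie in that field. -/
theorem exists_eq_algebraMap_of_isAlgebraic [IsDomain R] [Algebra k R] [DifferentialAlgebra k R]
    (hk : ∀ p : k[X], (∀ i, (p.coeff i)′ = 0) → 0 < p.degree → ∃ c : k, c′ = 0 ∧ p.IsRoot c)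
    {c : R} (hc : c′ = 0) (halg : IsAlgebraic k c) :
    ∃ a : k, a′ = 0 ∧ c = algebraMap k R a := by
  have hint := halg.isIntegral
  have hz : mapCoeffs (minpoly k c) = 0 := by
    by_contra hne
    have hroot : aeval c (mapCoeffs (minpoly k c)) = 0 := by
      simpa [hc] using (deriv_aeval_eq c (minpoly k c)).symm
    refine (minpoly.degree_le_of_ne_zero k c hne hroot).not_gt ?_
    refine (degree_lt_iff_coeff_zero _ _).2 ?_ |>.trans_eq (degree_eq_natDegree ?_).symm
    · intro i hi
      rw [coeff_mapCoeffs]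
      rcases hi.eq_or_lt with rfl | hi
      · simp [(minpoly.monic hint).coeff_natDegree]
      · simp [coeff_eq_zero_of_natDegree_lt hi]
    · exact minpoly.ne_zero hint
  obtain ⟨a, ha, hroot⟩ := hk (minpoly k c) (fun i ↦ by rw [← coeff_mapCoeffs, hz, coeff_zero])
    (minpoly.degree_pos hint)
  have hdeg := degree_eq_one_of_irreducible_of_root (minpoly.irreducible hint) hroot
  obtain ⟨b, rfl⟩ := minpoly.mem_range_of_degree_eq_one k c hdeg
  refine ⟨b, (algebraMap k R).injective ?_, rfl⟩
  rw [← deriv_algebraMap, hc, map_zero]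

/-- The constants of a finitely generated simple differential algebra over a field with
algebraically closed constants are constants of that field. -/
theorem IsSimple.exists_eq_algebraMap [CharZero k] [Algebra k R] [DifferentialAlgebra k R]
    [Algebra.FiniteType k R] (hR : IsSimple R)
    (hk : ∀ p : k[X], (∀ i, (p.coeff i)′ = 0) → 0 < p.degree → ∃ c : k, c′ = 0 ∧ p.IsRoot c)
    {c : R} (hc : c′ = 0) : ∃ a : k, a′ = 0 ∧ c = algebraMap k R a := by
  let : Algebra ℚ R := Algebra.compHom R (algebraMap ℚ k)
  have := hR.isDomain
  refine exists_eq_algebraMap_of_isAlgebraic hk hc ?_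
  by_contra htr
  obtain ⟨_, ⟨n, rfl⟩, hn⟩ := Transcendental.exists_not_isUnit_sub (k := k) htr
    (Set.infinite_range_of_injective (Nat.cast_injective (R := k)))
  refine hn (hR.isUnit_of_deriv_eq_zero (by simp [hc]) fun h0 ↦ htr ?_)
  rw [sub_eq_zero.1 h0]
  exact isAlgebraic_algebraMap _

/-- The constants of the fraction field of a simple differential domain lie in the ring. -/
theorem IsSimple.exists_algebraMap_eq (hR : IsSimple R) [IsDomain R] {K : Type*}
    [Field K] [Algebra R K] [IsFractionRing R K] [Differential K] [DifferentialAlgebra R K]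
    {x : K} (hx : x′ = 0) : ∃ c : R, c′ = 0 ∧ algebraMap R K c = x := by
  obtain ⟨⟨r, s⟩, hrs⟩ := IsLocalization.surj (nonZeroDivisors R) x
  let I : Ideal R :=
    (LinearMap.range (Algebra.linearMap R K)).comap (LinearMap.toSpanSingleton R K x)
  have hI : ∀ a ∈ I, a′ ∈ I := by
    rintro a ⟨b, hb⟩
    refine ⟨b′, ?_⟩
    have := congrArg (Differential.deriv (R := K)) hb
    simpa [Algebra.smul_def, hx, deriv_algebraMap, mul_comm] using this
  have htop := (hR.eq_bot_or_eq_top I hI).resolve_left fun h ↦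
    nonZeroDivisors.coe_ne_zero s <| (Submodule.eq_bot_iff I).1 h s ⟨r, by
      simpa [Algebra.smul_def, mul_comm] using hrs.symm⟩
  obtain ⟨c, hc⟩ := (Ideal.eq_top_iff_one I).1 htop
  have hcx : algebraMap R K c = x := by simpa using hc
  refine ⟨c, IsFractionRing.injective R K ?_, hcx⟩
  rw [← deriv_algebraMap, hcx, hx, map_zero]

end Differential

/-- The derivation underlying an additive map satisfying the Leibniz rule. -/
@[reducible]
def Differential.ofLeibniz {R : Type*} [CommRing R] (d : R → R)
    (hadd : ∀ a b, d (a + b) = d a + d b) (hmul : ∀ a b, d (a * b) = a * d b + d a * b) :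
    Differential R :=
  ⟨Derivation.mk' (AddMonoidHom.mk' d hadd).toIntLinearMap fun a b ↦ by
    simp [hmul, mul_comm]⟩

/-- If the constants of `k` form an algebraically closed field, then a Picard–Vessiot
ring `R` for `d(Y) = A·Y` over `k` is a domain, and the constants of its fraction field
(equipped with the unique extension of the derivation) are exactly the constants of
`k`. -/
theorem constants_of_fractionField_of_picardVessiotRing
    {k : Type*} [Field k] [CharZero k] (dk : k → k)
    (hdk_add : ∀ a b : k, dk (a + b) = dk a + dk b)
    (hdk_mul : ∀ a b : k, dk (a * b) = a * dk b + dk a * b)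
    (hC_algClosed : ∀ p : Polynomial k, (∀ i, dk (p.coeff i) = 0) → 0 < p.degree →
      ∃ c : k, dk c = 0 ∧ p.IsRoot c)
    {n : Type*} [Fintype n] [DecidableEq n] (A : Matrix n n k)
    {R : Type*} [CommRing R] [Algebra k R] (dR : R → R)
    (hPV : IsPicardVessiotRing dk A R dR) :
    IsDomain R ∧
    ∀ dK : FractionRing R → FractionRing R,
      (∀ x y : FractionRing R, dK (x + y) = dK x + dK y) →
      (∀ x y : FractionRing R, dK (x * y) = x * dK y + dK x * y) →
      (∀ a : R, dK (algebraMap R (FractionRing R) a) = algebraMap R (FractionRing R) (dR a)) →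
      ∀ x : FractionRing R,
        dK x = 0 ↔ ∃ c : k, dk c = 0 ∧
          x = algebraMap R (FractionRing R) (algebraMap k R c) := by
  obtain ⟨hadd, hmul, hmap, hne, hsimple, Z, w, -, -, hgen⟩ := hPV
  let : Differential k := .ofLeibniz dk hdk_add hdk_mul
  let : Differential R := .ofLeibniz dR hadd hmul
  have : DifferentialAlgebra k R := ⟨hmap⟩
  have : Nontrivial R := (Submodule.nontrivial_iff R).1 ⟨⊥, ⊤, hne⟩
  have hR : Differential.IsSimple R := ⟨inferInstance, hsimple⟩
  let : Algebra ℚ R := Algebra.compHom R (algebraMap ℚ k)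
  have hdom : IsDomain R := hR.isDomain
  have : Algebra.FiniteType k R :=
    ⟨(Subalgebra.fg_def).2 ⟨_, (Set.finite_range _).union (Set.finite_singleton w), hgen⟩⟩
  refine ⟨hdom, fun dK hKadd hKmul hKmap x ↦ ?_⟩
  let : Differential (FractionRing R) := .ofLeibniz dK hKadd hKmul
  have : DifferentialAlgebra R (FractionRing R) := ⟨hKmap⟩
  constructor
  · intro hx
    obtain ⟨c, hc, rfl⟩ := hR.exists_algebraMap_eq (x := x) hx
    obtain ⟨a, ha, rfl⟩ := hR.exists_eq_algebraMap hC_algClosed hc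
    exact ⟨a, ha, rfl⟩
  · rintro ⟨c, hc, rfl⟩
    rw [hKmap, hmap, hc, map_zero, map_zero]
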